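/- Let A be a centrally symmetric compact subset of a separable Banach space X, and suppose there exist r > 0, a ∈ ℝ and constants such that d_m(A,X) ≤ C₁ m^{−r}(log m)^a and ε_m(A,X) ≥ C₂ m^{−r}(log m)^a for all m ≥ 2. Then d_m(A,X) ≍ ε_m(A,X) ≍ m^{−r}(log m)^a, i.e., there also exist constants with ε_m(A,X) ≤ C₃ m^{−r}(log m)^a and d_m(A,X) ≥ C₄ m^{−r}(log m)^a for all m ≥ 2. -/

import Mathlib

open scoped BigOperators

/-- The Kolmogorov width `d_m(A, X)`. -/
noncomputable def kolWidth {X : Type*} [NormedAddCommGroup X] [NormedSpace ℝ X]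
    (m : ℕ) (A : Set X) : ℝ :=
  ⨅ u : Fin m → X, ⨆ f ∈ A, ⨅ c : Fin m → ℝ, ‖f - ∑ i, c i • u i‖

/-- The entropy number `ε_k(F, X)`. -/
noncomputable def entropyNum {X : Type*} [NormedAddCommGroup X] (k : ℕ) (F : Set X) : ℝ :=
  sInf {ε : ℝ | 0 < ε ∧ ∃ y : Fin (2 ^ k) → X, F ⊆ ⋃ j, Metric.closedBall (y j) ε}


lemma pack_card_le {E : Type*} [NormedAddCommGroup E] [NormedSpace ℝ E] [FiniteDimensional ℝ E]
    (s : Finset E) (R η : ℝ) (hR : 0 ≤ R) (hη : 0 < η) (hs : ∀ c ∈ s, ‖c‖ ≤ R)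
    (h : ∀ c ∈ s, ∀ d ∈ s, c ≠ d → η ≤ ‖c - d‖) :
    (s.card : ℝ) ≤ (1 + 2 * R / η) ^ Module.finrank ℝ E := by
  borelize E
  let μ : MeasureTheory.Measure E := MeasureTheory.Measure.addHaar
  set δ : ℝ := η / 2 with hδ
  set ρ : ℝ := R + η / 2 with hρ
  have δpos : 0 < δ := by positivity
  have ρpos : 0 < ρ := by positivity
  set A := ⋃ c ∈ s, Metric.ball (c : E) δ with hA
  have D : Set.Pairwise (s : Set E) (Function.onFun Disjoint fun c => Metric.ball (c : E) δ) := by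
    rintro c hc d hd hcd
    apply Metric.ball_disjoint_ball
    rw [dist_eq_norm]
    have := h c hc d hd hcd
    linarith
  have A_subset : A ⊆ Metric.ball (0 : E) ρ := by
    refine Set.iUnion₂_subset fun x hx => ?_
    apply Metric.ball_subset_ball'
    rw [dist_zero_right]
    have := hs x hx
    linarith
  have I :
    (s.card : ENNReal) * ENNReal.ofReal (δ ^ Module.finrank ℝ E) * μ (Metric.ball 0 1) ≤
      ENNReal.ofReal (ρ ^ Module.finrank ℝ E) * μ (Metric.ball 0 1) :=
    calc
      (s.card : ENNReal) * ENNReal.ofReal (δ ^ Module.finrank ℝ E) * μ (Metric.ball 0 1) = μ A := by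
        rw [hA, MeasureTheory.measure_biUnion_finset D fun c _ => measurableSet_ball]
        simp only [μ.addHaar_ball_of_pos _ δpos]
        simp only [Finset.sum_const, nsmul_eq_mul, mul_assoc]
      _ ≤ μ (Metric.ball (0 : E) ρ) := MeasureTheory.measure_mono A_subset
      _ = ENNReal.ofReal (ρ ^ Module.finrank ℝ E) * μ (Metric.ball 0 1) := by
        simp only [μ.addHaar_ball_of_pos _ ρpos]
  have J : (s.card : ENNReal) * ENNReal.ofReal (δ ^ Module.finrank ℝ E) ≤
      ENNReal.ofReal (ρ ^ Module.finrank ℝ E) :=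
    (ENNReal.mul_le_mul_iff_left (Metric.measure_ball_pos _ _ zero_lt_one).ne'
      MeasureTheory.measure_ball_lt_top.ne).1 I
  have K := ENNReal.toReal_le_of_le_ofReal (pow_nonneg ρpos.le _) J
  rw [ENNReal.toReal_mul, ENNReal.toReal_ofReal (by positivity), ENNReal.toReal_natCast] at K
  have e : 1 + 2 * R / η = ρ / δ := by
    rw [hρ, hδ]; field_simp; ring
  rw [e, div_pow, le_div_iff₀ (by positivity)]
  exact K

lemma cover_ball {E : Type*} [NormedAddCommGroup E] [NormedSpace ℝ E] [FiniteDimensional ℝ E]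
    (R η : ℝ) (hR : 0 ≤ R) (hη : 0 < η) (N : ℕ)
    (hN : (1 + 2 * R / η) ^ Module.finrank ℝ E ≤ (N : ℝ)) :
    ∃ s : Finset E, s.card ≤ N ∧ ∀ x : E, ‖x‖ ≤ R → ∃ c ∈ s, ‖x - c‖ ≤ η := by
  classical
  let P : ℕ → Prop := fun n => ∃ s : Finset E, s.card = n ∧ (∀ c ∈ s, ‖c‖ ≤ R) ∧
    (∀ c ∈ s, ∀ d ∈ s, c ≠ d → η ≤ ‖c - d‖)
  have hP0 : P 0 := ⟨∅, by simp⟩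
  have hb : ∀ n, P n → n ≤ N := by
    rintro n ⟨s, rfl, h1, h2⟩
    have := (pack_card_le s R η hR hη h1 h2).trans hN
    exact_mod_cast this
  obtain ⟨s, hs, h1, h2⟩ : P (Nat.findGreatest P N) := Nat.findGreatest_spec (Nat.zero_le N) hP0
  refine ⟨s, hs ▸ Nat.findGreatest_le N, fun x hx => ?_⟩
  by_contra! hc
  have hxs : x ∉ s := fun hxs => by
    have := hc x hxs
    simp at this
    linarith
  have hP : P (s.card + 1) := by
    refine ⟨insert x s, Finset.card_insert_of_notMem hxs, ?_, ?_⟩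
    · intro c hcm
      rcases Finset.mem_insert.1 hcm with rfl | hcm
      · exact hx
      · exact h1 c hcm
    · intro c hcm d hdm hcd
      rcases Finset.mem_insert.1 hcm with hcm | hcm <;> rcases Finset.mem_insert.1 hdm with hdm | hdm
      · exact absurd (hcm.trans hdm.symm) hcd
      · rw [hcm]; exact (hc d hdm).le
      · rw [hdm, norm_sub_rev]; exact (hc c hcm).le
      · exact h2 c hcm d hdm hcd
  have := Nat.le_findGreatest (hb _ hP) hP
  omega

/-- `A` is covered by `2 ^ n` closed balls of radius `ε`. -/
def BallCov {X : Type*} [NormedAddCommGroup X] (A : Set X) (n : ℕ) (ε : ℝ) : Prop :=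
  ∃ y : Fin (2 ^ n) → X, ∀ f ∈ A, ∃ j, ‖f - y j‖ ≤ ε

lemma finset_range {X : Type*} (s : Finset X) (hs : s.Nonempty) (N : ℕ) (h : s.card ≤ N) :
    ∃ y : Fin N → X, ∀ c ∈ s, ∃ j, y j = c := by
  have : Nonempty s := hs.to_subtype
  have hc : Fintype.card s ≤ Fintype.card (Fin N) := by simpa using h
  obtain ⟨e⟩ := Function.Embedding.nonempty_of_card_le hc
  refine ⟨fun j => (Function.invFun e j : s), fun c hcs => ⟨e ⟨c, hcs⟩, ?_⟩⟩
  simp only [Function.leftInverse_invFun e.injective (⟨c, hcs⟩ : s)]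

lemma BallCov.mono {X : Type*} [NormedAddCommGroup X] {A : Set X} {n n' : ℕ} {ε ε' : ℝ}
    (h : BallCov A n ε) (hn : n ≤ n') (hε : ε ≤ ε') : BallCov A n' ε' := by
  classical
  obtain ⟨y, hy⟩ := h
  obtain ⟨z, hz⟩ := finset_range (Finset.univ.image y) (Finset.univ_nonempty.image y) (2 ^ n')
    (Finset.card_image_le.trans (by simpa using Nat.pow_le_pow_right (by norm_num) hn))
  refine ⟨z, fun f hf => ?_⟩
  obtain ⟨j, hj⟩ := hy f hf
  obtain ⟨i, hi⟩ := hz (y j) (Finset.mem_image_of_mem _ (Finset.mem_univ _))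
  exact ⟨i, by rw [hi]; linarith⟩

lemma BallCov.step {X : Type*} [NormedAddCommGroup X] [NormedSpace ℝ X] {A : Set X} {n m b : ℕ}
    {ρ δ η : ℝ} (h : BallCov A n ρ) (hρ : 0 ≤ ρ) (hδ : 0 ≤ δ) (hη : 0 < η) (u : Fin m → X)
    (hu : ∀ f ∈ A, ∃ c : Fin m → ℝ, ‖f - ∑ i, c i • u i‖ ≤ δ)
    (hb : 1 + 4 * (ρ + δ) / η ≤ (2 : ℝ) ^ b) : BallCov A (n + b * m) (η + δ) := by
  obtain ⟨y, hy⟩ := h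
  let E := Submodule.span ℝ (Set.range u)
  have hEu : ∀ c : Fin m → ℝ, ∑ i, c i • u i ∈ E := fun c =>
    Submodule.sum_mem _ fun i _ => Submodule.smul_mem _ _ (Submodule.subset_span ⟨i, rfl⟩)
  have hdim : Module.finrank ℝ E ≤ m := by
    have h := finrank_range_le_card (R := ℝ) u
    rw [Fintype.card_fin] at h
    exact h
  have : FiniteDimensional ℝ E := FiniteDimensional.span_of_finite ℝ (Set.finite_range u)
  have key : ∀ j, ∃ z : Fin (2 ^ (b * m)) → X, ∀ f ∈ A, ‖f - y j‖ ≤ ρ →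
      ∃ k, ‖f - z k‖ ≤ η + δ := by
    intro j
    by_cases hne : ∃ f0 ∈ A, ‖f0 - y j‖ ≤ ρ
    · obtain ⟨f0, hf0, hfy⟩ := hne
      obtain ⟨c0, hc0⟩ := hu f0 hf0
      obtain ⟨s, hs, hcov⟩ := cover_ball (E := E) (2 * (ρ + δ)) η (by positivity) hη (2 ^ (b * m))
        (by
          have h1 : (1:ℝ) ≤ 1 + 2 * (2 * (ρ + δ)) / η := by
            have : 0 ≤ 2 * (2 * (ρ + δ)) / η := by positivity
            linarith
          calc (1 + 2 * (2 * (ρ + δ)) / η) ^ Module.finrank ℝ E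
              ≤ (1 + 2 * (2 * (ρ + δ)) / η) ^ m := pow_le_pow_right₀ h1 hdim
            _ ≤ ((2:ℝ) ^ b) ^ m := by
              refine pow_le_pow_left₀ (by linarith) ?_ m
              refine le_trans (le_of_eq ?_) hb
              ring
            _ = ((2 ^ (b * m) : ℕ) : ℝ) := by push_cast; rw [pow_mul])
      have hsn : s.Nonempty := by
        obtain ⟨c, hc, -⟩ := hcov 0 (by simp; positivity)
        exact ⟨c, hc⟩
      obtain ⟨z, hz⟩ := finset_range s hsn _ hs
      refine ⟨fun k => ∑ i, c0 i • u i + (z k : X), fun f hf hfj => ?_⟩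
      obtain ⟨c, hc⟩ := hu f hf
      obtain ⟨w, hw, hwn⟩ := hcov ⟨∑ i, c i • u i - ∑ i, c0 i • u i, E.sub_mem (hEu _) (hEu _)⟩ (by
        rw [Submodule.coe_norm]
        set g := ∑ i, c i • u i
        set g0 := ∑ i, c0 i • u i
        have e : g - g0 = (f - y j) - (f0 - y j) - (f - g) + (f0 - g0) := by abel
        show ‖g - g0‖ ≤ _
        rw [e]
        have h1 := norm_add_le ((f - y j) - (f0 - y j) - (f - g)) (f0 - g0)
        have h2 := norm_sub_le ((f - y j) - (f0 - y j)) (f - g)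
        have h3 := norm_sub_le (f - y j) (f0 - y j)
        linarith)
      obtain ⟨k, rfl⟩ := hz w hw
      refine ⟨k, ?_⟩
      rw [Submodule.coe_norm] at hwn
      rw [Submodule.coe_sub] at hwn
      simp only at hwn ⊢
      set g := ∑ i, c i • u i
      set g0 := ∑ i, c0 i • u i
      have e : f - (g0 + (z k : X)) = (g - g0 - z k) + (f - g) := by abel
      rw [e]
      have := norm_add_le (g - g0 - z k) (f - g)
      linarith
    · push Not at hne
      exact ⟨fun _ => 0, fun f hf hfj => absurd hfj (not_le.2 (hne f hf))⟩
  choose z hz using key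
  have hcard : 2 ^ (n + b * m) = 2 ^ n * 2 ^ (b * m) := pow_add _ _ _
  refine ⟨fun i => let p := finProdFinEquiv.symm (Fin.cast hcard i); z p.1 p.2, fun f hf => ?_⟩
  obtain ⟨j, hj⟩ := hy f hf
  obtain ⟨k, hk⟩ := hz j f hf hj
  refine ⟨Fin.cast hcard.symm (finProdFinEquiv (j, k)), ?_⟩
  simpa using hk

lemma entropy_le {X : Type*} [NormedAddCommGroup X] {A : Set X} {n : ℕ} {ε : ℝ}
    (hε : 0 < ε) (h : BallCov A n ε) : entropyNum n A ≤ ε := by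
  obtain ⟨y, hy⟩ := h
  refine csInf_le ⟨0, fun x hx => hx.1.le⟩ ⟨hε, y, fun f hf => ?_⟩
  obtain ⟨j, hj⟩ := hy f hf
  exact Set.mem_iUnion.2 ⟨j, by rwa [mem_closedBall_iff_norm]⟩

lemma cov_of_entropy_lt {X : Type*} [NormedAddCommGroup X] {A : Set X} {n : ℕ} {ε ε₀ : ℝ}
    (hne : 0 < ε₀) (h0 : BallCov A n ε₀) (h : entropyNum n A < ε) : BallCov A n ε := by
  obtain ⟨y0, hy0⟩ := h0
  have hn : {ε : ℝ | 0 < ε ∧ ∃ y : Fin (2 ^ n) → X,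
      A ⊆ ⋃ j, Metric.closedBall (y j) ε}.Nonempty := by
    refine ⟨ε₀, hne, y0, fun f hf => ?_⟩
    obtain ⟨j, hj⟩ := hy0 f hf
    exact Set.mem_iUnion.2 ⟨j, by rwa [mem_closedBall_iff_norm]⟩
  obtain ⟨e, ⟨he, y, hy⟩, hlt⟩ := exists_lt_of_csInf_lt hn h
  refine ⟨y, fun f hf => ?_⟩
  obtain ⟨j, hj⟩ := Set.mem_iUnion.1 (hy hf)
  exact ⟨j, (mem_closedBall_iff_norm.1 hj).trans hlt.le⟩

lemma exists_subspace {X : Type*} [NormedAddCommGroup X] [NormedSpace ℝ X] {A : Set X} {m : ℕ}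
    {M δ : ℝ} (hM0 : 0 ≤ M) (hM : ∀ f ∈ A, ‖f‖ ≤ M) (h : kolWidth m A < δ) :
    ∃ u : Fin m → X, ∀ f ∈ A, ∃ c : Fin m → ℝ, ‖f - ∑ i, c i • u i‖ ≤ δ := by
  obtain ⟨u, hu⟩ := exists_lt_of_ciInf_lt h
  refine ⟨u, fun f hf => ?_⟩
  have hbd : ∀ f : X, (⨆ (_ : f ∈ A), ⨅ c : Fin m → ℝ, ‖f - ∑ i, c i • u i‖) ≤ M := by
    intro f
    refine Real.iSup_le (fun hf => ?_) hM0
    refine (ciInf_le ⟨0, ?_⟩ (0 : Fin m → ℝ)).trans ?_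
    · rintro _ ⟨c, rfl⟩; positivity
    · simpa using hM f hf
  have h1 := le_ciSup (f := fun f : X => ⨆ (_ : f ∈ A), ⨅ c : Fin m → ℝ, ‖f - ∑ i, c i • u i‖)
    ⟨M, by rintro _ ⟨f, rfl⟩; exact hbd f⟩ f
  simp only [hf, ciSup_unique] at h1
  obtain ⟨c, hc⟩ := exists_lt_of_ciInf_lt (h1.trans_lt hu)
  exact ⟨c, hc.le⟩

/-- The comparison function `x ^ (-r) * (log x) ^ a`. -/
noncomputable def phiFn (r a x : ℝ) : ℝ := x ^ (-r) * (Real.log x) ^ a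

lemma phiFn_pos (r a : ℝ) {x : ℝ} (hx : 2 ≤ x) : 0 < phiFn r a x := by
  have : 0 < Real.log x := Real.log_pos (by linarith)
  unfold phiFn
  positivity

lemma phiFn_reg (r a : ℝ) (hr : 0 < r) {c x y : ℝ} (hx : 2 ≤ x) (hxy : x ≤ y) (hy : y ≤ c * x) :
    phiFn r a x ≤ (3 * c) ^ (r + |a|) * phiFn r a y ∧
    phiFn r a y ≤ (3 * c) ^ (r + |a|) * phiFn r a x := by
  have hx0 : 0 < x := by linarith
  have hy0 : 0 < y := by linarith
  have hc : 1 ≤ c := by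
    by_contra! h
    nlinarith
  have hc0 : 0 < c := by linarith
  have hlx : 0.69 < Real.log x := by
    have := Real.log_le_log (by norm_num) hx
    have := Real.log_two_gt_d9
    linarith
  have hlx0 : 0 < Real.log x := by linarith
  have hlxy : Real.log x ≤ Real.log y := Real.log_le_log hx0 hxy
  have hly : Real.log y ≤ Real.log c + Real.log x := by
    rw [← Real.log_mul hc0.ne' hx0.ne']
    exact Real.log_le_log hy0 hy
  have hlc : Real.log c ≤ c - 1 := Real.log_le_sub_one_of_pos hc0
  obtain ⟨s, rfl⟩ : ∃ s, y = s * x := ⟨y / x, by field_simp⟩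
  have hs1 : 1 ≤ s := by
    by_contra! h
    nlinarith
  have hsc : s ≤ c := le_of_mul_le_mul_right hy hx0
  obtain ⟨t, ht⟩ : ∃ t, Real.log (s * x) = t * Real.log x :=
    ⟨Real.log (s * x) / Real.log x, by field_simp⟩
  rw [ht] at hlxy hly
  have ht1 : 1 ≤ t := by
    by_contra! h
    nlinarith
  have htc : t ≤ 3 * c := by
    by_contra! h
    nlinarith
  have hs0 : 0 < s := by linarith
  have ht0 : 0 < t := by linarith
  have hφ : phiFn r a (s * x) = s ^ (-r) * t ^ a * phiFn r a x := by
    unfold phiFn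
    rw [ht, Real.mul_rpow hs0.le hx0.le, Real.mul_rpow ht0.le hlx0.le]
    ring
  have hp := phiFn_pos r a hx
  have hK : (3 * c) ^ (r + |a|) = (3 * c) ^ r * (3 * c) ^ |a| := Real.rpow_add (by positivity) _ _
  have k1 : (1:ℝ) ≤ (3 * c) ^ r := Real.one_le_rpow (by linarith) hr.le
  have k2 : s ^ r ≤ (3 * c) ^ r := Real.rpow_le_rpow hs0.le (by linarith) hr.le
  have k3 : t ^ |a| ≤ (3 * c) ^ |a| := Real.rpow_le_rpow ht0.le htc (abs_nonneg a)
  have k4 : t ^ a ≤ t ^ |a| := Real.rpow_le_rpow_of_exponent_le ht1 (le_abs_self a)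
  have k5 : t ^ (-a) ≤ t ^ |a| := Real.rpow_le_rpow_of_exponent_le ht1 (neg_le_abs a)
  have k6 : s ^ (-r) ≤ 1 := Real.rpow_le_one_of_one_le_of_nonpos hs1 (by linarith)
  have p1 : 0 < t ^ a := Real.rpow_pos_of_pos ht0 _
  have p2 : 0 < t ^ (-a) := Real.rpow_pos_of_pos ht0 _
  have p3 : 0 < s ^ (-r) := Real.rpow_pos_of_pos hs0 _
  have p4 : 0 < s ^ r := Real.rpow_pos_of_pos hs0 _
  have e1 : s ^ r * s ^ (-r) = 1 := by rw [← Real.rpow_add hs0]; simp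
  have e2 : t ^ (-a) * t ^ a = 1 := by rw [← Real.rpow_add ht0]; simp
  constructor
  · rw [hφ, hK]
    have h1 : s ^ r * t ^ (-a) ≤ (3 * c) ^ r * (3 * c) ^ |a| :=
      mul_le_mul k2 (k5.trans k3) p2.le (by positivity)
    calc phiFn r a x = (s ^ r * s ^ (-r)) * (t ^ (-a) * t ^ a) * phiFn r a x := by
          rw [e1, e2]; ring
      _ = (s ^ r * t ^ (-a)) * (s ^ (-r) * t ^ a * phiFn r a x) := by ring
      _ ≤ _ := mul_le_mul_of_nonneg_right h1 (by positivity)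
  · rw [hφ, hK]
    refine mul_le_mul_of_nonneg_right ?_ hp.le
    exact mul_le_mul (k6.trans k1) (k4.trans k3) p1.le (by positivity)

lemma ballCov_compact {X : Type*} [NormedAddCommGroup X] {A : Set X} (hA : IsCompact A)
    {ε : ℝ} (hε : 0 < ε) : ∃ n, BallCov A n ε := by
  obtain ⟨t, ht⟩ := hA.elim_finite_subcover (fun x : X => Metric.ball x ε)
    (fun _ => Metric.isOpen_ball) (fun f _ => Set.mem_iUnion.2 ⟨f, Metric.mem_ball_self hε⟩)
  rcases t.eq_empty_or_nonempty with rfl | hne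
  · exact ⟨0, fun _ => 0, fun f hf => by simpa using ht hf⟩
  · obtain ⟨y, hy⟩ := finset_range t hne (2 ^ t.card) Nat.lt_two_pow_self.le
    refine ⟨t.card, y, fun f hf => ?_⟩
    obtain ⟨c, hc, hfc⟩ := Set.mem_iUnion₂.1 (ht hf)
    obtain ⟨j, rfl⟩ := hy c hc
    exact ⟨j, (mem_ball_iff_norm.1 hfc).le⟩

lemma exists_two_pow_ge (x : ℝ) : ∃ b : ℕ, x ≤ (2:ℝ) ^ b := by
  obtain ⟨b, hb⟩ := pow_unbounded_of_one_lt x (by norm_num : (1:ℝ) < 2)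
  exact ⟨b, hb.le⟩

lemma upper_cov {X : Type*} [NormedAddCommGroup X] [NormedSpace ℝ X]
    (A : Set X) (hA : IsCompact A) (r a : ℝ) (hr : 0 < r) (C₁ : ℝ) (hC₁ : 0 < C₁)
    (M : ℝ) (hM0 : 0 < M) (hM : ∀ f ∈ A, ‖f‖ ≤ M)
    (hd : ∀ m : ℕ, 2 ≤ m → kolWidth m A ≤ C₁ * phiFn r a m) :
    ∃ C₃ : ℝ, 0 < C₃ ∧ ∀ m : ℕ, 2 ≤ m → BallCov A m (C₃ * phiFn r a m) := by
  set D : ℕ → ℝ := fun s => 2 * C₁ * phiFn r a ((2:ℝ) ^ s) with hD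
  have h2p : ∀ s : ℕ, 1 ≤ s → (2:ℝ) ≤ 2 ^ s := fun s hs => by
    simpa using pow_le_pow_right₀ (by norm_num : (1:ℝ) ≤ 2) hs
  have hDpos : ∀ s, 1 ≤ s → 0 < D s := fun s hs => by
    have := phiFn_pos r a (h2p s hs)
    simp only [hD]; positivity
  set K : ℝ := (3 * 2) ^ (r + |a|) with hK
  have hKpos : 0 < K := by positivity
  have hDK : ∀ s, 1 ≤ s → D s ≤ K * D (s + 1) := fun s hs => by
    have h1 : (2:ℝ) ^ s ≤ 2 ^ (s + 1) := pow_le_pow_right₀ (by norm_num) (by omega)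
    have := (phiFn_reg r a hr (c := 2) (h2p s hs) h1 (by rw [pow_succ]; linarith)).1
    simp only [hD]
    calc _ ≤ 2 * C₁ * (K * phiFn r a (2 ^ (s + 1))) := by gcongr
      _ = _ := by ring
  obtain ⟨b, hb⟩ := exists_two_pow_ge (1 + 4 * (2 * K + 1))
  obtain ⟨n, hn⟩ := ballCov_compact hA (ε := 2 * D 1) (by have := hDpos 1 le_rfl; positivity)
  obtain ⟨β, hβ⟩ : ∃ β : ℕ, 2 * b + n ≤ 2 ^ β := ⟨2 * b + n, Nat.lt_two_pow_self.le⟩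
  have hmain : ∀ s, 1 ≤ s → BallCov A (2 ^ (β + s)) (2 * D s) := by
    intro s hs
    induction s, hs using Nat.le_induction with
    | base =>
      refine hn.mono ?_ le_rfl
      rw [pow_succ]; omega
    | succ s hs ih =>
      have hp := hDpos s hs
      have hp' := hDpos (s + 1) (by omega)
      have hm2 : 2 ≤ 2 ^ (s + 1) := by
        rw [pow_succ]; have := Nat.one_le_two_pow (n := s); omega
      obtain ⟨u, hu⟩ := exists_subspace (m := 2 ^ (s + 1)) (δ := D (s + 1)) hM0.le hM (by
        refine (hd _ hm2).trans_lt ?_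
        simp only [hD]
        push_cast
        have := phiFn_pos r a (h2p (s + 1) (by omega))
        have := mul_pos hC₁ this
        linarith)
      have := ih.step (by positivity) hp'.le hp' u hu (b := b) (by
        refine le_trans ?_ hb
        have : (2 * D s + D (s + 1)) / D (s + 1) ≤ 2 * K + 1 := by
          rw [div_le_iff₀ hp']
          have := hDK s hs
          linarith
        rw [mul_div_assoc]
        linarith)
      refine this.mono ?_ (by linarith)
      have e : β + (s + 1) = (β + s) + 1 := by ring
      rw [e, pow_succ, pow_succ, pow_add]
      have : 2 * b * 2 ^ s ≤ 2 ^ β * 2 ^ s := Nat.mul_le_mul_right _ (by omega)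
      nlinarith
  set L : ℝ := (3 * (2:ℝ) ^ (β + 1)) ^ (r + |a|) with hL
  have hLpos : 0 < L := by positivity
  have hφ2 := phiFn_pos r a (le_refl (2:ℝ))
  refine ⟨4 * C₁ * L + M / phiFn r a 2 * L, by positivity, fun m hm => ?_⟩
  have hmR : (2:ℝ) ≤ m := by exact_mod_cast hm
  have hφm := phiFn_pos r a hmR
  have q1 : 0 ≤ M / phiFn r a 2 * L * phiFn r a m := by positivity
  have q2 : 0 ≤ 4 * C₁ * L * phiFn r a m := by positivity
  rcases lt_or_ge m (2 ^ (β + 1)) with hlt | hge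
  · have h1 : (m : ℝ) < 2 ^ (β + 1) := by exact_mod_cast hlt
    have h2 : phiFn r a 2 ≤ L * phiFn r a m :=
      (phiFn_reg r a hr (c := 2 ^ (β + 1)) le_rfl hmR (by linarith)).1
    refine ⟨fun _ => 0, fun f hf => ⟨⟨0, by positivity⟩, ?_⟩⟩
    rw [sub_zero]
    refine (hM f hf).trans ?_
    have : M ≤ M / phiFn r a 2 * (L * phiFn r a m) := by
      rw [div_mul_eq_mul_div, le_div_iff₀ hφ2]
      gcongr
    linarith
  · have hlog : β + 1 ≤ Nat.log 2 m := Nat.le_log_of_pow_le (by norm_num) hge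
    obtain ⟨s, hs⟩ := Nat.exists_eq_add_of_le hlog
    have h1 : 2 ^ (β + (s + 1)) ≤ m := by
      have := Nat.pow_log_le_self 2 (x := m) (by omega)
      rw [hs] at this
      convert this using 2; ring
    have h2 : m < 2 ^ (β + (s + 1) + 1) := by
      have := Nat.lt_pow_succ_log_self (b := 2) (by norm_num) m
      rw [hs] at this
      convert this using 2; omega
    have h3 : 2 ^ (s + 1) ≤ m := (Nat.pow_le_pow_right (by norm_num) (by omega)).trans h1
    refine (hmain (s + 1) (by omega)).mono h1 ?_
    have h4 := (phiFn_reg r a hr (c := 2 ^ (β + 1)) (h2p (s + 1) (by omega)) (y := m)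
      (by exact_mod_cast h3) (by
        rw [← pow_add]
        have : (m:ℝ) < 2 ^ (β + (s + 1) + 1) := by exact_mod_cast h2
        refine this.le.trans (le_of_eq ?_)
        congr 1; ring)).1
    have : 2 * D (s + 1) ≤ 4 * C₁ * (L * phiFn r a m) := by
      simp only [hD]
      have := mul_le_mul_of_nonneg_left h4 (by positivity : 0 ≤ 4 * C₁)
      linarith
    linarith

lemma exists_good_b (q C : ℝ) (hC : 0 < C) (b0 : ℕ) :
    ∃ b : ℕ, (1 / 2 : ℝ) ^ b * (3 * ((1 + b0 + b : ℕ) : ℝ)) ^ q < C := by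
  obtain ⟨k, hk⟩ := exists_nat_ge q
  have ht := tendsto_pow_const_mul_const_pow_of_abs_lt_one k
    (by rw [abs_of_pos] <;> norm_num : |(1 / 2 : ℝ)| < 1)
  have ht2 := ht.const_mul (3 ^ k * 2 ^ (1 + b0) : ℝ)
  rw [mul_zero] at ht2
  obtain ⟨n, hn, hnb⟩ := ((ht2.eventually_lt_const hC).and
    (Filter.eventually_ge_atTop (1 + b0))).exists
  obtain ⟨b, rfl⟩ := Nat.exists_eq_add_of_le hnb
  refine ⟨b, lt_of_le_of_lt ?_ hn⟩
  set N : ℝ := ((1 + b0 + b : ℕ) : ℝ) with hN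
  have hN1 : 1 ≤ N := by rw [hN]; push_cast; linarith [b0.cast_nonneg (α := ℝ), b.cast_nonneg (α := ℝ)]
  have h1 : (3 * N) ^ q ≤ 3 ^ k * N ^ k := by
    rw [← mul_pow, ← Real.rpow_natCast]
    exact Real.rpow_le_rpow_of_exponent_le (by linarith) hk
  have h2 : (2:ℝ) ^ (1 + b0) * (1 / 2 : ℝ) ^ (1 + b0 + b) = (1 / 2) ^ b := by
    rw [pow_add (1/2 : ℝ), ← mul_assoc, ← mul_pow]; norm_num
  calc (1 / 2 : ℝ) ^ b * (3 * N) ^ q ≤ (1 / 2 : ℝ) ^ b * (3 ^ k * N ^ k) := by gcongr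
    _ = _ := by rw [← h2]; ring

lemma lower_width {X : Type*} [NormedAddCommGroup X] [NormedSpace ℝ X]
    (A : Set X) (r a : ℝ) (hr : 0 < r) (C₂ : ℝ) (hC₂ : 0 < C₂)
    (M : ℝ) (hM0 : 0 < M) (hM : ∀ f ∈ A, ‖f‖ ≤ M) (C : ℝ) (hC : 0 < C)
    (hcov : ∀ m : ℕ, 2 ≤ m → BallCov A m (C * phiFn r a m))
    (he : ∀ m : ℕ, 2 ≤ m → C₂ * phiFn r a m ≤ entropyNum m A) :
    ∃ C₄ : ℝ, 0 < C₄ ∧ ∀ m : ℕ, 2 ≤ m → C₄ * phiFn r a m ≤ kolWidth m A := by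
  obtain ⟨b0, hb0⟩ := exists_two_pow_ge (1 + 4 * (C + 1))
  obtain ⟨b, hb⟩ := exists_good_b (r + |a|) (C₂ / 2) (by positivity) b0
  set T : ℝ := (3 * ((1 + b0 + b : ℕ) : ℝ)) ^ (r + |a|) with hT
  have hTpos : 0 < T := by positivity
  set C₄ : ℝ := min 1 (C₂ / (4 * T)) with hC₄
  have hC₄pos : 0 < C₄ := by rw [hC₄]; positivity
  have hC₄1 : C₄ ≤ 1 := min_le_left _ _
  have hC₄T : C₄ * T ≤ C₂ / 4 := by
    calc C₄ * T ≤ C₂ / (4 * T) * T := by gcongr; exact min_le_right _ _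
      _ = C₂ / 4 := by field_simp
  refine ⟨C₄, hC₄pos, fun m hm => ?_⟩
  by_contra! hlt
  obtain ⟨u, hu⟩ := exists_subspace hM0.le hM hlt
  have hmR : (2:ℝ) ≤ m := by exact_mod_cast hm
  have hφ := phiFn_pos r a hmR
  have hstep := (hcov m hm).step (by positivity) (by positivity)
    (η := (1 / 2 : ℝ) ^ b * phiFn r a m) (by positivity) u hu (b := b0 + b) (by
      have e : 4 * (C * phiFn r a m + C₄ * phiFn r a m) / ((1 / 2 : ℝ) ^ b * phiFn r a m)
          = 4 * (C + C₄) * 2 ^ b := by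
        rw [one_div, inv_pow]; field_simp
      rw [e, pow_add]
      have h1 : (1:ℝ) ≤ 2 ^ b := one_le_pow₀ (by norm_num)
      calc 1 + 4 * (C + C₄) * 2 ^ b ≤ 2 ^ b + 4 * (C + 1) * 2 ^ b := by gcongr
        _ = (1 + 4 * (C + 1)) * 2 ^ b := by ring
        _ ≤ _ := by gcongr)
  have hE : m + (b0 + b) * m = (1 + b0 + b) * m := by ring
  rw [hE] at hstep
  have hle : m ≤ (1 + b0 + b) * m := Nat.le_mul_of_pos_left _ (by omega)
  have h1 := (he _ (hm.trans hle)).trans (entropy_le (by positivity) hstep)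
  have h2 := (phiFn_reg r a hr (c := ((1 + b0 + b : ℕ) : ℝ)) hmR
    (y := (((1 + b0 + b) * m : ℕ) : ℝ)) (by exact_mod_cast hle) (by push_cast; exact le_rfl)).1
  have hφ' := phiFn_pos r a (x := (((1 + b0 + b) * m : ℕ) : ℝ)) (by exact_mod_cast hm.trans hle)
  rw [← hT] at h2
  have h3 : C₂ * phiFn r a (((1 + b0 + b) * m : ℕ) : ℝ) ≤
      ((1 / 2 : ℝ) ^ b + C₄) * (T * phiFn r a (((1 + b0 + b) * m : ℕ) : ℝ)) := by
    refine h1.trans ?_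
    rw [← add_mul]
    gcongr
  rw [← mul_assoc] at h3
  have h4 := le_of_mul_le_mul_right h3 hφ'
  rw [add_mul] at h4
  linarith

/-- If `A` is a centrally symmetric compact subset of a separable Banach space `X`
with `d_m(A,X) ≤ C₁ m^{-r}(log m)^a` and `ε_m(A,X) ≥ C₂ m^{-r}(log m)^a` for `m ≥ 2`,
then both `d_m(A,X)` and `ε_m(A,X)` are of order `m^{-r}(log m)^a`. -/
theorem width_entropy_two_sided {X : Type*} [NormedAddCommGroup X] [NormedSpace ℝ X]
    [CompleteSpace X] [TopologicalSpace.SeparableSpace X]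
    (A : Set X) (hA : IsCompact A) (hsymm : A = -A)
    (r a : ℝ) (hr : 0 < r) (C₁ C₂ : ℝ) (hC₁ : 0 < C₁) (hC₂ : 0 < C₂)
    (hd : ∀ m : ℕ, 2 ≤ m → kolWidth m A ≤ C₁ * (m : ℝ) ^ (-r) * (Real.log m) ^ a)
    (he : ∀ m : ℕ, 2 ≤ m → C₂ * (m : ℝ) ^ (-r) * (Real.log m) ^ a ≤ entropyNum m A) :
    ∃ C₃ C₄ : ℝ, 0 < C₃ ∧ 0 < C₄ ∧
      (∀ m : ℕ, 2 ≤ m → entropyNum m A ≤ C₃ * (m : ℝ) ^ (-r) * (Real.log m) ^ a) ∧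
      (∀ m : ℕ, 2 ≤ m → C₄ * (m : ℝ) ^ (-r) * (Real.log m) ^ a ≤ kolWidth m A) := by
  obtain ⟨M, hM0, hM⟩ : ∃ M : ℝ, 0 < M ∧ ∀ f ∈ A, ‖f‖ ≤ M :=
    hA.isBounded.exists_pos_norm_le
  have hd' : ∀ m : ℕ, 2 ≤ m → kolWidth m A ≤ C₁ * phiFn r a m := fun m hm => by
    simpa only [phiFn, mul_assoc] using hd m hm
  have he' : ∀ m : ℕ, 2 ≤ m → C₂ * phiFn r a m ≤ entropyNum m A := fun m hm => by
    simpa only [phiFn, mul_assoc] using he m hm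
  obtain ⟨C₃, hC₃, hcov⟩ := upper_cov A hA r a hr C₁ hC₁ M hM0 hM hd'
  obtain ⟨C₄, hC₄, hlow⟩ := lower_width A r a hr C₂ hC₂ M hM0 hM C₃ hC₃ hcov he'
  refine ⟨C₃, C₄, hC₃, hC₄, fun m hm => ?_, fun m hm => ?_⟩
  · have hφ := phiFn_pos r a (x := m) (by exact_mod_cast hm)
    have := entropy_le (by positivity) (hcov m hm)
    simpa only [phiFn, mul_assoc] using this
  · simpa only [phiFn, mul_assoc] using hlow m hm
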